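/- There exists a function η : ℝ → ℝ of class C^∞ which is nonincreasing, satisfies 0 ≤ η(x) ≤ 1 for all x ∈ ℝ, η(x) = 1 for all x ≤ 0, η(x) = 0 for all x ≥ 1, and whose derivatives satisfy |η''(x)| ≤ 8 and (η'(x))^2 ≤ 16·η(x) for all x ∈ ℝ. -/

import Mathlib

theorem shi_mono {F f : ℝ → ℝ} (hF : ∀ x, HasDerivAt F (f x) x) {a b : ℝ} (hab : a ≤ b)
    (h : ∀ x, a ≤ x → x ≤ b → 0 ≤ f x) : F a ≤ F b := by
  have : MonotoneOn F (Set.Icc a b) := by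
    apply monotoneOn_of_deriv_nonneg (convex_Icc a b)
    · exact fun x _ => (hF x).continuousAt.continuousWithinAt
    · exact fun x _ => (hF x).differentiableAt.differentiableWithinAt
    · intro x hx
      rw [interior_Icc] at hx
      rw [(hF x).deriv]
      exact h x hx.1.le hx.2.le
  exact this ⟨le_rfl, hab⟩ ⟨hab, le_rfl⟩ hab

theorem shi_const {F f : ℝ → ℝ} (hF : ∀ x, HasDerivAt F (f x) x) {a b : ℝ} (hab : a ≤ b)
    (h : ∀ x, a ≤ x → x ≤ b → f x = 0) : F a = F b := by
  apply le_antisymm (shi_mono hF hab (fun x h1 h2 => (h x h1 h2).ge))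
  have := shi_mono (F := fun x => - F x) (fun x => (hF x).neg) hab
    (fun x h1 h2 => by rw [h x h1 h2]; simp)
  linarith

theorem shi_prim (f : ℝ → ℝ) (hf : ContDiff ℝ (⊤ : ℕ∞) f) :
    ∃ F : ℝ → ℝ, ContDiff ℝ (⊤ : ℕ∞) F ∧ (∀ x, HasDerivAt F (f x) x) ∧ F 0 = 0 := by
  have h : ∀ x, HasDerivAt (fun x => ∫ t in (0:ℝ)..x, f t) (f x) x := fun x =>
    intervalIntegral.integral_hasDerivAt_right (hf.continuous.intervalIntegrable _ _)
      (hf.continuous.stronglyMeasurableAtFilter _ _) hf.continuous.continuousAt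
  refine ⟨_, ?_, h, by simp⟩
  rw [contDiff_infty_iff_deriv]
  refine ⟨fun x => (h x).differentiableAt, ?_⟩
  rwa [show deriv (fun x => ∫ t in (0:ℝ)..x, f t) = f from funext fun x => (h x).deriv]

theorem shi_bump : ∃ φ : ℝ → ℝ, ContDiff ℝ (⊤ : ℕ∞) φ ∧ (∀ x, 0 ≤ φ x) ∧ (∀ x, φ x ≤ 1) ∧
    (∀ x ≤ 0, φ x = 0) ∧ (∀ x, 1/2 ≤ x → φ x = 0) ∧
    (∀ x, 1/20 ≤ x → x ≤ 9/20 → φ x = 1) := by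
  let B : ContDiffBump (1/4 : ℝ) := ⟨1/5, 1/4, by norm_num, by norm_num⟩
  refine ⟨B, B.contDiff, fun x => B.nonneg, fun x => B.le_one, fun x hx => ?_, fun x hx => ?_,
    fun x h1 h2 => ?_⟩
  · apply B.zero_of_le_dist
    rw [Real.dist_eq]
    change 1/4 ≤ _
    rw [le_abs]; right; linarith
  · apply B.zero_of_le_dist
    rw [Real.dist_eq]
    change 1/4 ≤ _
    rw [le_abs]; left; linarith
  · apply B.one_of_mem_closedBall
    rw [Metric.mem_closedBall, Real.dist_eq]
    change _ ≤ 1/5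
    rw [abs_le]; constructor <;> linarith

/-- Existence of Shi's cutoff profile: a smooth nonincreasing function `η : ℝ → ℝ`
with `0 ≤ η ≤ 1`, `η ≡ 1` on `(-∞,0]`, `η ≡ 0` on `[1,∞)`, `|η''| ≤ 8` and
`(η')² ≤ 16·η` everywhere. -/
theorem exists_shi_cutoff :
    ∃ η : ℝ → ℝ, ContDiff ℝ (⊤ : ℕ∞) η ∧ Antitone η ∧
      (∀ x, 0 ≤ η x ∧ η x ≤ 1) ∧
      (∀ x ≤ 0, η x = 1) ∧
      (∀ x, 1 ≤ x → η x = 0) ∧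
      (∀ x, |deriv (deriv η) x| ≤ 8) ∧
      (∀ x, (deriv η x) ^ 2 ≤ 16 * η x) := by
  obtain ⟨φ, hφ, φ0, φ1, φl, φr, φm⟩ := shi_bump
  obtain ⟨P, hP, dP, P0⟩ := shi_prim φ hφ
  have Pneg : ∀ x ≤ 0, P x = 0 := fun x hx => by
    rw [shi_const dP hx (fun y _ h => φl y h), P0]
  have Pge : ∀ x, 1/2 ≤ x → P x = P (1/2) := fun x hx =>
    (shi_const dP hx (fun y h _ => φr y h)).symm
  have Pmono : ∀ x y, x ≤ y → P x ≤ P y := fun x y h => shi_mono dP h (fun z _ _ => φ0 z)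
  have Pnn : ∀ x, 0 ≤ P x := fun x => by
    rcases le_total x 0 with h | h
    · exact (Pneg x h).ge
    · have := Pmono 0 x h; linarith
  have Plin : ∀ x, 1/20 ≤ x → x ≤ 9/20 → x - 1/20 ≤ P x := fun x h1 h2 => by
    have := shi_mono (fun x => (dP x).sub (hasDerivAt_id x)) h1
      (fun y h3 h4 => by rw [φm y h3 (h4.trans h2)]; simp)
    have h5 := Pnn (1/20)
    simp only [Pi.sub_apply, id] at this
    linarith
  obtain ⟨D, hD⟩ : ∃ D : ℝ → ℝ, D = fun x => P x + P (1 - x) - P (1/2) := ⟨_, rfl⟩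
  have cD : ContDiff ℝ (⊤ : ℕ∞) D := by
    rw [hD]
    exact (hP.add (hP.comp (contDiff_const.sub contDiff_id))).sub contDiff_const
  have dD : ∀ x, HasDerivAt D (φ x - φ (1 - x)) x := fun x => by
    rw [hD]
    have h1 : HasDerivAt (fun x : ℝ => P (1 - x)) (φ (1 - x) * (-1)) x :=
      (dP (1 - x)).comp x ((hasDerivAt_id x).const_sub 1)
    have := ((dP x).add h1).sub_const (P (1/2))
    exact this.congr_deriv (by ring)
  have Dl : ∀ x ≤ 1/2, D x = P x := fun x hx => by
    simp only [hD]; rw [Pge (1 - x) (by linarith)]; ring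
  have Dr : ∀ x, 1/2 ≤ x → D x = P (1 - x) := fun x hx => by
    simp only [hD]; rw [Pge x hx]; ring
  have Dnn : ∀ x, 0 ≤ D x := fun x => by
    rcases le_total x (1/2) with h | h
    · rw [Dl x h]; exact Pnn _
    · rw [Dr x h]; exact Pnn _
  have D0 : ∀ x ≤ 0, D x = 0 := fun x hx => by rw [Dl x (by linarith), Pneg x hx]
  have D1 : ∀ x, 1 ≤ x → D x = 0 := fun x hx => by
    rw [Dr x (by linarith), Pneg _ (by linarith)]
  obtain ⟨E, cE, dE, E0⟩ := shi_prim D cD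
  have Emono : ∀ x y, x ≤ y → E x ≤ E y := fun x y h => shi_mono dE h (fun z _ _ => Dnn z)
  have Eneg : ∀ x ≤ 0, E x = 0 := fun x hx => by
    rw [shi_const dE hx (fun y _ h => D0 y h), E0]
  have Ege : ∀ x, 1 ≤ x → E x = E 1 := fun x hx =>
    (shi_const dE hx (fun y h _ => D1 y h)).symm
  have q : ∀ c x : ℝ, HasDerivAt (fun x : ℝ => (x - c)^2/2) (x - c) x := fun c x => by
    have := (((hasDerivAt_id x).sub_const c).pow 2).div_const 2
    exact this.congr_deriv (by simp)
  have E1 : 1/8 ≤ E 1 := by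
    have a1 := shi_mono (fun x => (dE x).sub (q (1/20) x)) (a := 1/20) (b := 9/20) (by norm_num)
      (fun y h3 h4 => by rw [Dl y (by linarith)]; linarith [Plin y h3 h4])
    have a2 := shi_mono (fun x => (dE x).add (q (19/20) x)) (a := 11/20) (b := 19/20) (by norm_num)
      (fun y h3 h4 => by
        rw [Dr y (by linarith)]; linarith [Plin (1 - y) (by linarith) (by linarith)])
    have a3 := Emono 0 (1/20) (by norm_num)
    have a4 := Emono (9/20) (11/20) (by norm_num)
    have a5 := Emono (19/20) 1 (by norm_num)
    simp only [Pi.sub_apply, Pi.add_apply] at a1 a2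
    norm_num at a1 a2 a3 a4 a5 ⊢
    linarith
  have Ep : 0 < E 1 := by linarith
  obtain ⟨η, hη⟩ : ∃ η : ℝ → ℝ, η = fun x => 1 - E x / E 1 := ⟨_, rfl⟩
  have cη : ContDiff ℝ (⊤ : ℕ∞) η := by
    rw [hη]; exact contDiff_const.sub (cE.div_const _)
  have dη : ∀ x, HasDerivAt η (-(D x / E 1)) x := fun x => by
    rw [hη]; exact ((dE x).div_const _).const_sub 1
  have dη' : deriv η = fun x => -(D x / E 1) := funext fun x => (dη x).deriv
  have ddη : ∀ x, HasDerivAt (deriv η) (-((φ x - φ (1 - x)) / E 1)) x := fun x => by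
    rw [dη']; exact ((dD x).div_const _).neg
  have anti : Antitone η := fun x y h => by
    simp only [hη]
    have := div_le_div_of_nonneg_right (Emono x y h) Ep.le
    linarith
  have h0 : ∀ x ≤ 0, η x = 1 := fun x hx => by simp [hη, Eneg x hx]
  have h1 : ∀ x, 1 ≤ x → η x = 0 := fun x hx => by simp [hη, Ege x hx, Ep.ne']
  have nn : ∀ x, 0 ≤ η x := fun x => by
    rw [← h1 (max x 1) (le_max_right _ _)]; exact anti (le_max_left _ _)
  have le1 : ∀ x, η x ≤ 1 := fun x => by
    rw [← h0 (min x 0) (min_le_right _ _)]; exact anti (min_le_left _ _)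
  have bd : ∀ x, |-((φ x - φ (1 - x)) / E 1)| ≤ 8 := fun x => by
    rw [abs_neg, abs_div, abs_of_pos Ep, div_le_iff₀ Ep]
    have : |φ x - φ (1 - x)| ≤ 1 := by
      rw [abs_le]
      constructor <;> linarith [φ0 x, φ1 x, φ0 (1 - x), φ1 (1 - x)]
    linarith
  refine ⟨η, cη, anti, fun x => ⟨nn x, le1 x⟩, h0, h1, fun x => ?_, fun x => ?_⟩
  · rw [(ddη x).deriv]; exact bd x
  · have np : deriv η x ≤ 0 := by
      rw [dη']
      have := div_nonneg (Dnn x) Ep.le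
      simpa using this
    have s1 : ∀ y, x ≤ y → deriv η y ≤ deriv η x + 8 * (y - x) := fun y hy => by
      have := shi_mono (fun z => ((hasDerivAt_id z).const_mul 8).sub (ddη z)) hy
        (fun z _ _ => by linarith [(abs_le.1 (bd z)).2])
      simp only [Pi.sub_apply, id] at this
      linarith
    have s2 := shi_mono (a := x) (b := x - deriv η x / 8)
      (fun z => (((hasDerivAt_id z).const_mul (deriv η x)).add ((q x z).const_mul 8)).sub
        ((dη z).differentiableAt.hasDerivAt)) (by linarith)
        (fun z hz _ => by linarith [s1 z hz])
    simp only [Pi.sub_apply, Pi.add_apply, id] at s2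
    have := nn (x - deriv η x / 8)
    nlinarith
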